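/- Let p, q ≥ 3 be integers at least one of which is even. Then the determinant of the distance matrix of G(p,q;0) = ∞(p,1,q) equals 0, and the determinant of the distance matrix of G(p,q;1) equals 0. -/

import Mathlib

open SimpleGraph Matrix

/-- The distance matrix of a graph, with entries in `ℚ`: the `(i,j)` entry is the
graph distance (length of a shortest path) between `i` and `j`. -/
noncomputable def distMatrix {V : Type*} (G : SimpleGraph V) : Matrix V V ℚ :=
  fun i j => (G.dist i j : ℚ)

/-- The graph `G(p,q;n)` on `Fin (p+q-1+n)`: the graph `∞(p,1,q)` — the cycle `C_p`
on `0, …, p-1` and the cycle `C_q` on `0, p, …, p+q-2`, sharing the center vertex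
`0` — together with a pendant path `0, p+q-1, p+q, …, p+q-2+n` on `n` new vertices
planted at the center vertex.  In particular `G(p,q;0) = ∞(p,1,q)`. -/
def Gpq (p q n : ℕ) : SimpleGraph (Fin (p + q - 1 + n)) :=
  SimpleGraph.fromRel (fun a b =>
    ((a : ℕ) + 1 = (b : ℕ) ∧ (b : ℕ) < p) ∨
    ((a : ℕ) = 0 ∧ (b : ℕ) = p - 1) ∨
    ((a : ℕ) = 0 ∧ (b : ℕ) = p) ∨
    (p ≤ (a : ℕ) ∧ (a : ℕ) + 1 = (b : ℕ) ∧ (b : ℕ) ≤ p + q - 2) ∨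
    ((a : ℕ) = 0 ∧ (b : ℕ) = p + q - 2) ∨
    (1 ≤ n ∧ (a : ℕ) = 0 ∧ (b : ℕ) = p + q - 1) ∨
    (p + q - 1 ≤ (a : ℕ) ∧ (a : ℕ) + 1 = (b : ℕ)))

/-- The distance between the vertices `i` and `j` of the cycle on `0, …, m-1`. -/
def cycleDist (m i j : ℕ) : ℕ := min ((i - j) + (j - i)) (m - ((i - j) + (j - i)))

/-- The position of the vertex `x` on the first cycle of `Gpq p q n`, after the other
vertices have been retracted to the center. -/
def firstPos (p x : ℕ) : ℕ := if x < p then x else 0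

/-- The position of the vertex `x` on the second cycle of `Gpq p q n`, after the other
vertices have been retracted to the center. -/
def secondPos (p q x : ℕ) : ℕ := if p ≤ x ∧ x ≤ p + q - 2 then x - p + 1 else 0

/-- The position of the vertex `x` on the pendant path of `Gpq p q n`, after the other
vertices have been retracted to the center. -/
def pathPos (p q x : ℕ) : ℕ := x - (p + q - 2)

/-- The distance in `Gpq p q n`, as the sum of the distances in the two cycles and the path. -/
def blockDist (p q v x : ℕ) : ℕ :=
  cycleDist p (firstPos p v) (firstPos p x) + cycleDist q (secondPos p q v) (secondPos p q x) +
    ((pathPos p q v - pathPos p q x) + (pathPos p q x - pathPos p q v))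

theorem SimpleGraph.dist_eq_of_descent {V : Type*} {G : SimpleGraph V} {v : V} (F : V → ℕ)
    (hv : F v = 0) (hadj : ∀ a b, G.Adj a b → F b ≤ F a + 1)
    (hdesc : ∀ x, x ≠ v → ∃ y, G.Adj y x ∧ F y + 1 = F x) (x : V) : G.dist v x = F x := by
  have hwalk : ∀ k x, F x = k → ∃ w : G.Walk v x, w.length = k := by
    intro k
    induction k with
    | zero =>
      intro x hx
      by_cases h : x = v
      · subst h
        exact ⟨.nil, rfl⟩
      · obtain ⟨y, -, hy⟩ := hdesc x h
        omega
    | succ k ih =>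
      intro x hx
      have h : x ≠ v := by
        rintro rfl
        omega
      obtain ⟨y, hyx, hy⟩ := hdesc x h
      obtain ⟨w, hw⟩ := ih y (by omega)
      exact ⟨w.concat hyx, by simp [hw]⟩
  have hle : ∀ {a b : V} (w : G.Walk a b), F b ≤ F a + w.length := by
    intro a b w
    induction w with
    | nil => simp
    | cons h w ih =>
      have := hadj _ _ h
      simp only [Walk.length_cons]
      omega
  obtain ⟨w, hw⟩ := hwalk _ x rfl
  obtain ⟨w', hw'⟩ := w.reachable.exists_walk_length_eq_dist
  have h₁ := dist_le w
  have h₂ := hle w'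
  omega

theorem Gpq_adj_iff {p q n : ℕ} (hp : 3 ≤ p) (hq : 3 ≤ q) (a b : Fin (p + q - 1 + n)) :
    (Gpq p q n).Adj a b ↔
      (∃ x y : ℕ, ((a : ℕ) = x ∧ (b : ℕ) = y ∨ (a : ℕ) = y ∧ (b : ℕ) = x) ∧
      ((x + 1 = y ∧ y < p) ∨ (x = 0 ∧ y = p - 1) ∨ (x = 0 ∧ y = p) ∨
        (p ≤ x ∧ x + 1 = y ∧ y ≤ p + q - 2) ∨ (x = 0 ∧ y = p + q - 2) ∨
        (x = 0 ∧ y = p + q - 1) ∨ (p + q - 1 ≤ x ∧ x + 1 = y))) := by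
  have ha := a.isLt
  have hb := b.isLt
  simp only [Gpq, SimpleGraph.fromRel_adj, ne_eq, Fin.ext_iff]
  constructor
  · rintro ⟨-, h | h⟩
    · exact ⟨a, b, by omega, by omega⟩
    · exact ⟨b, a, by omega, by omega⟩
  · rintro ⟨x, y, ⟨hx, hy⟩ | ⟨hx, hy⟩, h⟩
    · rw [hx] at ha ⊢
      rw [hy] at hb ⊢
      refine ⟨by omega, .inl ?_⟩
      rcases h with h | h | h | h | h | h | h
      exacts [.inl h, .inr (.inl h), .inr (.inr (.inl h)), .inr (.inr (.inr (.inl h))),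
        .inr (.inr (.inr (.inr (.inl h)))),
        .inr (.inr (.inr (.inr (.inr (.inl ⟨by omega, h⟩))))),
        .inr (.inr (.inr (.inr (.inr (.inr h)))))]
    · rw [hx] at ha ⊢
      rw [hy] at hb ⊢
      refine ⟨by omega, .inr ?_⟩
      rcases h with h | h | h | h | h | h | h
      exacts [.inl h, .inr (.inl h), .inr (.inr (.inl h)), .inr (.inr (.inr (.inl h))),
        .inr (.inr (.inr (.inr (.inl h)))),
        .inr (.inr (.inr (.inr (.inr (.inl ⟨by omega, h⟩))))),
        .inr (.inr (.inr (.inr (.inr (.inr h)))))]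

theorem cycleDist_succ {m i j : ℕ} (hi : i < m) (hj : j + 1 < m) :
    cycleDist m i j ≤ cycleDist m i (j + 1) + 1 ∧
      cycleDist m i (j + 1) ≤ cycleDist m i j + 1 := by
  unfold cycleDist
  omega

theorem cycleDist_wrap {m i : ℕ} (hi : i < m) :
    cycleDist m i 0 ≤ cycleDist m i (m - 1) + 1 ∧
      cycleDist m i (m - 1) ≤ cycleDist m i 0 + 1 := by
  unfold cycleDist
  omega

theorem exists_cycleDist_descent {m i j : ℕ} (hi : i < m) (hj : j < m) (hij : i ≠ j) :
    ∃ k < m, (k + 1 = j ∨ j + 1 = k ∨ (k = 0 ∧ j = m - 1) ∨ (j = 0 ∧ k = m - 1)) ∧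
      cycleDist m i k + 1 = cycleDist m i j := by
  unfold cycleDist
  by_cases h : i < j
  · by_cases h' : j - i ≤ m - (j - i)
    · exact ⟨j - 1, by omega, by omega, by omega⟩
    · by_cases h'' : j + 1 < m
      · exact ⟨j + 1, by omega, by omega, by omega⟩
      · exact ⟨0, by omega, by omega, by omega⟩
  · by_cases h' : i - j ≤ m - (i - j)
    · exact ⟨j + 1, by omega, by omega, by omega⟩
    · by_cases h'' : j = 0
      · exact ⟨m - 1, by omega, by omega, by omega⟩
      · exact ⟨j - 1, by omega, by omega, by omega⟩

theorem cycleDist_antipodal {k j : ℕ} (hk : 2 ≤ k) (hj : j < k + k) :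
    cycleDist (k + k) 0 j + cycleDist (k + k) k j =
      cycleDist (k + k) 1 j + cycleDist (k + k) (k + 1) j := by
  unfold cycleDist
  omega

theorem cycleDist_self (m i : ℕ) : cycleDist m i i = 0 := by
  simp [cycleDist]

theorem firstPos_lt {p : ℕ} (hp : 0 < p) (x : ℕ) : firstPos p x < p := by
  unfold firstPos
  split_ifs <;> omega

theorem secondPos_lt {p q : ℕ} (hq : 3 ≤ q) (x : ℕ) : secondPos p q x < q := by
  unfold secondPos
  split_ifs <;> omega

theorem pos_of_lt {p q x : ℕ} (hq : 3 ≤ q) (hx : x < p) :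
    firstPos p x = x ∧ secondPos p q x = 0 ∧ pathPos p q x = 0 := by
  unfold firstPos secondPos pathPos
  refine ⟨?_, ?_, ?_⟩ <;> (try split_ifs) <;> omega

theorem pos_of_mem_second {p q j : ℕ} (hp : 3 ≤ p) (hj : j + 1 < q) :
    firstPos p (p + j) = 0 ∧ secondPos p q (p + j) = j + 1 ∧ pathPos p q (p + j) = 0 := by
  unfold firstPos secondPos pathPos
  refine ⟨?_, ?_, ?_⟩ <;> (try split_ifs) <;> omega

theorem pos_of_mem_path {p q : ℕ} (hp : 3 ≤ p) (hq : 3 ≤ q) (j : ℕ) :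
    firstPos p (p + q - 1 + j) = 0 ∧ secondPos p q (p + q - 1 + j) = 0 ∧
      pathPos p q (p + q - 1 + j) = j + 1 := by
  unfold firstPos secondPos pathPos
  refine ⟨?_, ?_, ?_⟩ <;> (try split_ifs) <;> omega

theorem vertex_cases (p q : ℕ) (x : ℕ) :
    x < p ∨ (∃ j, j + 1 < q ∧ x = p + j) ∨ ∃ j, x = p + q - 1 + j := by
  by_cases h : x < p
  · exact .inl h
  by_cases h' : x < p + q - 1
  · exact .inr (.inl ⟨x - p, by omega, by omega⟩)
  · exact .inr (.inr ⟨x - (p + q - 1), by omega⟩)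

theorem blockDist_adj {p q n : ℕ} (hp : 3 ≤ p) (hq : 3 ≤ q) (v : ℕ)
    (a b : Fin (p + q - 1 + n)) (h : (Gpq p q n).Adj a b) :
    blockDist p q v b ≤ blockDist p q v a + 1 := by
  have hv₁ := firstPos_lt (p := p) (by omega) v
  have hv₂ := secondPos_lt (p := p) hq v
  suffices H : ∀ x y : ℕ, ((x + 1 = y ∧ y < p) ∨ (x = 0 ∧ y = p - 1) ∨ (x = 0 ∧ y = p) ∨
        (p ≤ x ∧ x + 1 = y ∧ y ≤ p + q - 2) ∨ (x = 0 ∧ y = p + q - 2) ∨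
        (x = 0 ∧ y = p + q - 1) ∨ (p + q - 1 ≤ x ∧ x + 1 = y)) →
      blockDist p q v x ≤ blockDist p q v y + 1 ∧ blockDist p q v y ≤ blockDist p q v x + 1 by
    obtain ⟨x, y, ⟨ha, hb⟩ | ⟨ha, hb⟩, h⟩ := (Gpq_adj_iff hp hq a b).1 h <;>
      rw [ha, hb]
    exacts [(H x y h).2, (H x y h).1]
  obtain ⟨z₁, z₂, z₃⟩ := pos_of_lt (p := p) (x := 0) hq (by omega)
  rintro x y (⟨rfl, h⟩ | ⟨rfl, rfl⟩ | ⟨rfl, rfl⟩ | ⟨h₁, rfl, h₂⟩ | ⟨rfl, rfl⟩ | ⟨rfl, rfl⟩ |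
    ⟨h, rfl⟩)
  · obtain ⟨x₁, x₂, x₃⟩ := pos_of_lt (p := p) (x := x) hq (by omega)
    obtain ⟨y₁, y₂, y₃⟩ := pos_of_lt hq h
    have := cycleDist_succ hv₁ h
    simp only [blockDist, x₁, x₂, x₃, y₁, y₂, y₃]
    omega
  · obtain ⟨y₁, y₂, y₃⟩ := pos_of_lt (p := p) (x := p - 1) hq (by omega)
    have := cycleDist_wrap hv₁
    simp only [blockDist, z₁, z₂, z₃, y₁, y₂, y₃]
    omega
  · obtain ⟨y₁, y₂, y₃⟩ := pos_of_mem_second (q := q) (j := 0) hp (by omega)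
    have := cycleDist_succ (j := 0) hv₂ (by omega)
    simp only [Nat.add_zero] at y₁ y₂ y₃
    simp only [blockDist, z₁, z₂, z₃, y₁, y₂, y₃]
    omega
  · obtain ⟨j, rfl⟩ := Nat.exists_eq_add_of_le h₁
    obtain ⟨x₁, x₂, x₃⟩ := pos_of_mem_second (q := q) (j := j) hp (by omega)
    obtain ⟨y₁, y₂, y₃⟩ := pos_of_mem_second (q := q) (j := j + 1) hp (by omega)
    have := cycleDist_succ (j := j + 1) hv₂ (by omega)
    rw [← Nat.add_assoc] at y₁ y₂ y₃
    simp only [blockDist, x₁, x₂, x₃, y₁, y₂, y₃]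
    omega
  · obtain ⟨y₁, y₂, y₃⟩ := pos_of_mem_second (q := q) (j := q - 2) hp (by omega)
    have := cycleDist_wrap hv₂
    rw [show q - 2 + 1 = q - 1 by omega] at y₂
    rw [show p + q - 2 = p + (q - 2) by omega]
    simp only [blockDist, z₁, z₂, z₃, y₁, y₂, y₃]
    omega
  · obtain ⟨y₁, y₂, y₃⟩ := pos_of_mem_path hp hq 0
    simp only [Nat.add_zero] at y₁ y₂ y₃
    simp only [blockDist, z₁, z₂, z₃, y₁, y₂, y₃]
    omega
  · obtain ⟨j, rfl⟩ := Nat.exists_eq_add_of_le h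
    obtain ⟨x₁, x₂, x₃⟩ := pos_of_mem_path hp hq j
    obtain ⟨y₁, y₂, y₃⟩ := pos_of_mem_path hp hq (j + 1)
    rw [← Nat.add_assoc] at y₁ y₂ y₃
    simp only [blockDist, x₁, x₂, x₃, y₁, y₂, y₃]
    omega

theorem exists_descent_first {p q n : ℕ} (hp : 3 ≤ p) (hq : 3 ≤ q) {v : ℕ}
    (x : Fin (p + q - 1 + n)) (hx : (x : ℕ) < p) (hvx : firstPos p v ≠ x) :
    ∃ y, (Gpq p q n).Adj y x ∧ blockDist p q v y + 1 = blockDist p q v x := by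
  obtain ⟨k, hk, hadj, hd⟩ := exists_cycleDist_descent (firstPos_lt (by omega) v) hx hvx
  refine ⟨⟨k, by omega⟩, (Gpq_adj_iff hp hq _ _).2 ?_, ?_⟩
  · rcases hadj with h | h | h | h
    · exact ⟨k, x, .inl ⟨rfl, rfl⟩, by omega⟩
    · exact ⟨x, k, .inr ⟨rfl, rfl⟩, by omega⟩
    · exact ⟨k, x, .inl ⟨rfl, rfl⟩, by omega⟩
    · exact ⟨x, k, .inr ⟨rfl, rfl⟩, by omega⟩
  · obtain ⟨x₁, x₂, x₃⟩ := pos_of_lt (p := p) hq hx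
    obtain ⟨y₁, y₂, y₃⟩ := pos_of_lt (p := p) hq hk
    simp only [blockDist, x₁, x₂, x₃, y₁, y₂, y₃]
    omega

/-- The vertex of `Gpq p q n` at position `j` of the second cycle. -/
def secondVertex (p j : ℕ) : ℕ := if j = 0 then 0 else p + (j - 1)

theorem pos_secondVertex {p q j : ℕ} (hp : 3 ≤ p) (hq : 3 ≤ q) (hj : j < q) :
    firstPos p (secondVertex p j) = 0 ∧ secondPos p q (secondVertex p j) = j ∧
      pathPos p q (secondVertex p j) = 0 := by
  unfold secondVertex
  split_ifs with h
  · subst h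
    exact pos_of_lt hq (by omega)
  · have := pos_of_mem_second (q := q) (j := j - 1) hp (by omega)
    rwa [show j - 1 + 1 = j by omega] at this

theorem secondVertex_lt {p q n j : ℕ} (hp : 3 ≤ p) (hj : j < q) :
    secondVertex p j < p + q - 1 + n := by
  unfold secondVertex
  split_ifs <;> omega

theorem exists_descent_second {p q n : ℕ} (hp : 3 ≤ p) (hq : 3 ≤ q) {v j : ℕ}
    (x : Fin (p + q - 1 + n)) (hj : j < q) (hx : (x : ℕ) = secondVertex p j)
    (hvx : secondPos p q v ≠ j) :
    ∃ y, (Gpq p q n).Adj y x ∧ blockDist p q v y + 1 = blockDist p q v x := by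
  obtain ⟨k, hk, hadj, hd⟩ := exists_cycleDist_descent (secondPos_lt (p := p) hq v) hj hvx
  refine ⟨⟨secondVertex p k, secondVertex_lt hp hk⟩, (Gpq_adj_iff hp hq _ _).2 ?_, ?_⟩
  · rw [hx]
    by_cases h : k < j
    · refine ⟨_, _, .inl ⟨rfl, rfl⟩, ?_⟩
      simp only [secondVertex]
      split_ifs <;> omega
    · refine ⟨_, _, .inr ⟨rfl, rfl⟩, ?_⟩
      simp only [secondVertex]
      split_ifs <;> omega
  · obtain ⟨x₁, x₂, x₃⟩ := pos_secondVertex hp hq hj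
    obtain ⟨y₁, y₂, y₃⟩ := pos_secondVertex hp hq hk
    simp only [hx, blockDist, x₁, x₂, x₃, y₁, y₂, y₃]
    omega

theorem exists_descent_path {p q n : ℕ} (hp : 3 ≤ p) (hq : 3 ≤ q) {v j : ℕ}
    (x : Fin (p + q - 1 + n)) (hx : (x : ℕ) = p + q - 1 + j) (hvx : pathPos p q v < j + 1) :
    ∃ y, (Gpq p q n).Adj y x ∧ blockDist p q v y + 1 = blockDist p q v x := by
  obtain ⟨x₁, x₂, x₃⟩ := pos_of_mem_path hp hq j
  cases j with
  | zero =>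
    refine ⟨⟨0, by omega⟩, (Gpq_adj_iff hp hq _ _).2 ⟨_, _, .inl ⟨rfl, rfl⟩, by dsimp only; omega⟩, ?_⟩
    obtain ⟨y₁, y₂, y₃⟩ := pos_of_lt (p := p) (x := 0) hq (by omega)
    simp only [hx, blockDist, x₁, x₂, x₃, y₁, y₂, y₃]
    omega
  | succ j =>
    refine ⟨⟨p + q - 1 + j, by omega⟩,
      (Gpq_adj_iff hp hq _ _).2 ⟨_, _, .inl ⟨rfl, rfl⟩, by dsimp only; omega⟩, ?_⟩
    obtain ⟨y₁, y₂, y₃⟩ := pos_of_mem_path hp hq j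
    simp only [hx, blockDist, x₁, x₂, x₃, y₁, y₂, y₃]
    omega

theorem Gpq_dist {p q n : ℕ} (hp : 3 ≤ p) (hq : 3 ≤ q) (v x : Fin (p + q - 1 + n))
    (hv : (v : ℕ) < p + q - 1) : (Gpq p q n).dist v x = blockDist p q v x := by
  refine SimpleGraph.dist_eq_of_descent (fun x : Fin (p + q - 1 + n) => blockDist p q v x) ?_
    (blockDist_adj hp hq v) ?_ x
  · simp [blockDist, cycleDist_self]
  intro x hxv
  have hxv' : (x : ℕ) ≠ v := fun h => hxv (Fin.ext h)
  have hpath : pathPos p q v = 0 := by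
    unfold pathPos
    omega
  rcases vertex_cases p q x with hx | ⟨j, hj, hx⟩ | ⟨j, hx⟩
  · by_cases h : firstPos p v = x
    · have h₀ : (x : ℕ) = 0 := by
        unfold firstPos at h
        split_ifs at h <;> omega
      refine exists_descent_second hp hq (j := 0) x (by omega) (by simp [secondVertex, h₀]) ?_
      unfold firstPos at h
      unfold secondPos
      split_ifs at h ⊢ <;> omega
    · exact exists_descent_first hp hq x hx h
  · refine exists_descent_second hp hq (j := j + 1) x hj (by simp [secondVertex, hx]) ?_
    unfold secondPos
    split_ifs <;> omega
  · exact exists_descent_path hp hq x hx (by omega)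

theorem Matrix.det_eq_zero_of_row_add_eq {m : Type*} [Fintype m] [DecidableEq m]
    {M : Matrix m m ℚ} {a b c d : m} (hab : a ≠ b) (hac : a ≠ c) (had : a ≠ d)
    (h : ∀ x, M a x + M b x = M c x + M d x) : M.det = 0 := by
  refine Matrix.exists_vecMul_eq_zero_iff.1
    ⟨Pi.single a 1 + Pi.single b 1 - Pi.single c 1 - Pi.single d 1, ?_, ?_⟩
  · intro h0
    have := congrFun h0 a
    simp [hab, hac, had] at this
  · ext x
    simp only [Matrix.sub_vecMul, Matrix.add_vecMul, Matrix.single_one_vecMul, Pi.sub_apply,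
      Pi.add_apply, Pi.zero_apply, Matrix.row_apply]
    linarith [h x]

theorem det_distMatrix_Gpq_eq_zero {p q : ℕ} (n : ℕ) (hp : 3 ≤ p) (hq : 3 ≤ q)
    (heven : Even p ∨ Even q) : (distMatrix (Gpq p q n)).det = 0 := by
  obtain ⟨k, rfl⟩ | ⟨k, rfl⟩ := heven
  · refine Matrix.det_eq_zero_of_row_add_eq (a := ⟨0, by omega⟩) (b := ⟨k, by omega⟩)
      (c := ⟨1, by omega⟩) (d := ⟨k + 1, by omega⟩) (by simp; omega) (by simp) (by simp) ?_
    intro x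
    simp only [distMatrix]
    rw [Gpq_dist hp hq _ _ (by simp; omega), Gpq_dist hp hq _ _ (by simp; omega),
      Gpq_dist hp hq _ _ (by simp; omega), Gpq_dist hp hq _ _ (by simp; omega)]
    have := cycleDist_antipodal (k := k) (by omega) (firstPos_lt (p := k + k) (by omega) x)
    obtain ⟨a₁, a₂, a₃⟩ := pos_of_lt (p := k + k) (x := 0) hq (by omega)
    obtain ⟨b₁, b₂, b₃⟩ := pos_of_lt (p := k + k) (x := k) hq (by omega)
    obtain ⟨c₁, c₂, c₃⟩ := pos_of_lt (p := k + k) (x := 1) hq (by omega)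
    obtain ⟨d₁, d₂, d₃⟩ := pos_of_lt (p := k + k) (x := k + 1) hq (by omega)
    norm_cast
    simp only [blockDist, a₁, a₂, a₃, b₁, b₂, b₃, c₁, c₂, c₃, d₁, d₂, d₃]
    omega
  · have hlt : ∀ j < k + k, secondVertex p j < p + (k + k) - 1 := fun j hj =>
      secondVertex_lt (n := 0) hp hj
    have hinj : ∀ j, j ≠ 0 → secondVertex p 0 ≠ secondVertex p j := by
      intro j hj
      simp only [secondVertex, hj, if_true, if_false]
      omega
    refine Matrix.det_eq_zero_of_row_add_eq
      (a := ⟨secondVertex p 0, secondVertex_lt hp (by omega)⟩)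
      (b := ⟨secondVertex p k, secondVertex_lt hp (by omega)⟩)
      (c := ⟨secondVertex p 1, secondVertex_lt hp (by omega)⟩)
      (d := ⟨secondVertex p (k + 1), secondVertex_lt hp (by omega)⟩)
      (by simpa using hinj k (by omega)) (by simpa using hinj 1 (by omega))
      (by simpa using hinj (k + 1) (by omega)) ?_
    intro x
    simp only [distMatrix]
    rw [Gpq_dist hp hq _ _ (hlt 0 (by omega)), Gpq_dist hp hq _ _ (hlt k (by omega)),
      Gpq_dist hp hq _ _ (hlt 1 (by omega)), Gpq_dist hp hq _ _ (hlt (k + 1) (by omega))]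
    have := cycleDist_antipodal (k := k) (by omega) (secondPos_lt (p := p) (q := k + k) hq x)
    obtain ⟨a₁, a₂, a₃⟩ := pos_secondVertex (j := 0) hp hq (by omega)
    obtain ⟨b₁, b₂, b₃⟩ := pos_secondVertex (j := k) hp hq (by omega)
    obtain ⟨c₁, c₂, c₃⟩ := pos_secondVertex (j := 1) hp hq (by omega)
    obtain ⟨d₁, d₂, d₃⟩ := pos_secondVertex (j := k + 1) hp hq (by omega)
    norm_cast
    simp only [blockDist, a₁, a₂, a₃, b₁, b₂, b₃, c₁, c₂, c₃, d₁, d₂, d₃]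
    omega

/-- If `p, q ≥ 3` and at least one of them is even, then the distance matrices of
`G(p,q;0) = ∞(p,1,q)` and of `G(p,q;1)` both have determinant `0`. -/
theorem det_distMatrix_Gpq_zero_of_even (p q : ℕ) (hp : 3 ≤ p) (hq : 3 ≤ q)
    (heven : Even p ∨ Even q) :
    (distMatrix (Gpq p q 0)).det = 0 ∧ (distMatrix (Gpq p q 1)).det = 0 := by
  exact ⟨det_distMatrix_Gpq_eq_zero 0 hp hq heven, det_distMatrix_Gpq_eq_zero 1 hp hq heven⟩
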